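/- The fifteen complexes N_1, N_2, …, N_15 are pairwise non-isomorphic. -/

import Mathlib

/-! Basic framework for finite simplicial complexes, pseudomanifolds and
bistellar moves, following Datta–Nilakantan. A complex is recorded as the
finite set of its faces (nonempty finite subsets of the vertex type). -/

namespace NPM

variable {α β : Type*} [DecidableEq α] [DecidableEq β]

/-- A "complex" datum: a finite family of finite subsets of `α`. -/
abbrev Complex (α : Type*) := Finset (Finset α)

/-- `K` is a simplicial complex: a nonempty collection of nonempty sets,
closed under passing to nonempty subsets. -/
def IsComplex (K : Complex α) : Prop :=
  K.Nonempty ∧ (∀ σ ∈ K, σ.Nonempty) ∧ ∀ σ ∈ K, ∀ τ ⊆ σ, τ.Nonempty → τ ∈ K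

/-- The vertex set of `K`. -/
def verts (K : Complex α) : Finset α := K.sup id

/-- `K` is pure of dimension `d`: every face is contained in a face with
`d+1` vertices. -/
def IsPure (K : Complex α) (d : ℕ) : Prop :=
  ∀ σ ∈ K, ∃ τ ∈ K, σ ⊆ τ ∧ τ.card = d + 1

/-- The facets ("`d`-faces") of a pure `d`-dimensional complex. -/
def facets (K : Complex α) (d : ℕ) : Complex α := K.filter (fun σ => σ.card = d + 1)

/-- The link of a face `σ` in `K`. -/
def link (K : Complex α) (σ : Finset α) : Complex α :=
  K.filter (fun τ => Disjoint τ σ ∧ σ ∪ τ ∈ K)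

/-- The degree of a face: the number of vertices of its link. -/
def degree (K : Complex α) (σ : Finset α) : ℕ := (verts (link K σ)).card

/-- A weak `d`-pseudomanifold: a pure `d`-dimensional complex in which every
`(d-1)`-face (i.e. face with `d` vertices) lies in exactly two facets. -/
def WeakPM (K : Complex α) (d : ℕ) : Prop :=
  IsComplex K ∧ IsPure K d ∧
    ∀ σ ∈ K, σ.card = d → (K.filter fun τ => σ ⊆ τ ∧ τ.card = d + 1).card = 2

/-- Strong connectedness: any two facets are joined by a chain of facets in
which consecutive facets meet in a `(d-1)`-face. -/
def SConn (K : Complex α) (d : ℕ) : Prop :=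
  ∀ σ ∈ facets K d, ∀ τ ∈ facets K d,
    Relation.ReflTransGen
      (fun a b => a ∈ facets K d ∧ b ∈ facets K d ∧ (a ∩ b).card = d) σ τ

/-- A `d`-pseudomanifold: a strongly connected weak `d`-pseudomanifold. -/
def IsPM (K : Complex α) (d : ℕ) : Prop := WeakPM K d ∧ SConn K d

/-- Connectedness of a complex: the graph of vertices and edges is connected. -/
def Conn (K : Complex α) : Prop :=
  (verts K).Nonempty ∧ ∀ u ∈ verts K, ∀ v ∈ verts K,
    Relation.ReflTransGen (fun a b => a ≠ b ∧ ({a, b} : Finset α) ∈ K) u v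

/-- A normal `d`-pseudomanifold: a connected weak `d`-pseudomanifold in which
the link of every face of dimension `≤ d - 2` is connected. -/
def NormalPM (K : Complex α) (d : ℕ) : Prop :=
  WeakPM K d ∧ Conn K ∧ ∀ σ ∈ K, σ.card + 1 ≤ d → Conn (link K σ)

/-- `K` is neighbourly: every pair of vertices forms an edge. -/
def Neighbourly (K : Complex α) : Prop :=
  ∀ u ∈ verts K, ∀ v ∈ verts K, u ≠ v → ({u, v} : Finset α) ∈ K

/-- Isomorphism of complexes: a map injective on the vertex set carrying the
faces of `K` exactly onto the faces of `L`. -/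
def Iso (K : Complex α) (L : Complex β) : Prop :=
  ∃ f : α → β, Set.InjOn f ↑(verts K) ∧ L = K.image (fun σ => σ.image f)

/-- The complex generated by a family of facets: all nonempty subsets. -/
def genCx (F : Finset (Finset α)) : Complex α :=
  F.biUnion fun σ => σ.powerset.filter (fun τ => τ.Nonempty)

/-- The standard sphere on the vertex set `B`: all nonempty proper subsets
of `B`. -/
def stdSphere (B : Finset α) : Complex α :=
  B.powerset.filter fun τ => τ.Nonempty ∧ τ ≠ B

/-- In a weak `d`-pseudomanifold, a removable `(d-i)`-face `A`: its link is a
standard sphere `S^{i-1}_{i+1}(B)` with `B` not a face.  (For `d = 3`,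
`i = 1` gives removable 2-faces and `i = 2` gives removable 1-faces.) -/
def RemovableFace (d i : ℕ) (K : Complex α) (A : Finset α) : Prop :=
  A ∈ K ∧ A.card = d - i + 1 ∧
    ∃ B : Finset α, B.card = i + 1 ∧ B ∉ K ∧ link K A = stdSphere B

/-- The bistellar `i`-move (`0 < i ≤ d`) relation on weak `d`-pseudomanifolds:
`L` is obtained from `K` by removing a removable `(d-i)`-face `A` with
`link K A = stdSphere B` and inserting the facets `(B ∪ A) \ {v}`, `v ∈ A`. -/
def BMove (d i : ℕ) (K L : Complex α) : Prop :=
  ∃ A B : Finset α, A ∈ K ∧ A.card = d - i + 1 ∧ B.card = i + 1 ∧ B ∉ K ∧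
    link K A = stdSphere B ∧
    L = genCx ((facets K d).filter (fun σ => ¬ A ⊆ σ) ∪
          A.image fun v => (B ∪ A).erase v)

/-- The bistellar `0`-move: star a new vertex `w` in a facet `σ`. -/
def BMove0 (d : ℕ) (K L : Complex α) : Prop :=
  ∃ σ w, σ ∈ K ∧ σ.card = d + 1 ∧ w ∉ verts K ∧
    L = genCx (((facets K d).erase σ) ∪ σ.image fun v => insert w (σ.erase v))

/-- A single bistellar move of any type `0 ≤ i ≤ d`. -/
def BStep (d : ℕ) (K L : Complex α) : Prop :=
  BMove0 d K L ∨ ∃ i, 0 < i ∧ i ≤ d ∧ BMove d i K L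

/-- Bistellar equivalence: a finite sequence of bistellar moves. -/
def BEquiv (d : ℕ) : Complex α → Complex α → Prop :=
  Relation.ReflTransGen (BStep d)

/-- A proper bistellar move: a bistellar `i`-move with `0 < i < d`. -/
def PMove (d : ℕ) (K L : Complex α) : Prop := ∃ i, 0 < i ∧ i < d ∧ BMove d i K L

/-- Proper bistellar equivalence. -/
def PEquiv (d : ℕ) : Complex α → Complex α → Prop :=
  Relation.ReflTransGen (PMove d)

/-- The result of the bistellar move on the face `A` of the weak
`d`-pseudomanifold `K` (deterministic form: `B` is the vertex set of
`link K A`). -/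
def kappa (d : ℕ) (K : Complex α) (A : Finset α) : Complex α :=
  genCx ((facets K d).filter (fun σ => ¬ A ⊆ σ) ∪
    A.image fun v => (verts (link K A) ∪ A).erase v)

/-- A cycle: a (finite) 1-pseudomanifold. -/
def Cycle (K : Complex α) : Prop := IsPM K 1

/-- A combinatorial 2-manifold: a weak 2-pseudomanifold all whose vertex
links are cycles. -/
def Comb2Mfd (K : Complex α) : Prop :=
  WeakPM K 2 ∧ ∀ v, ({v} : Finset α) ∈ K → Cycle (link K {v})

/-- The Euler characteristic `f₀ - f₁ + f₂` of a 2-dimensional complex. -/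
def eulerChar (K : Complex α) : ℤ :=
  ((K.filter fun σ => σ.card = 1).card : ℤ) -
    ((K.filter fun σ => σ.card = 2).card : ℤ) +
    ((K.filter fun σ => σ.card = 3).card : ℤ)

/-- A combinatorial 2-sphere: a connected combinatorial 2-manifold with
Euler characteristic 2. -/
def Comb2Sphere (K : Complex α) : Prop := Comb2Mfd K ∧ Conn K ∧ eulerChar K = 2

/-- A combinatorial 3-manifold: a 3-pseudomanifold all whose vertex links are
combinatorial 2-spheres. -/
def Comb3Mfd (K : Complex α) : Prop :=
  IsPM K 3 ∧ ∀ v, ({v} : Finset α) ∈ K → Comb2Sphere (link K {v})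

end NPM

/-- The complex `N1` from the paper, generated by its facets. -/
def N1 : NPM.Complex ℕ :=
  NPM.genCx {{1,2,4,8}, {1,2,6,8}, {1,3,4,8}, {1,3,7,8}, {1,5,6,8}, {1,5,7,8}, {2,3,5,8}, {2,3,7,8}, {2,4,5,8}, {2,6,7,8}, {3,4,6,8}, {3,5,6,8}, {4,5,7,8}, {4,6,7,8}, {1,2,4,7}, {1,2,5,7}, {1,3,6,7}, {1,4,6,7}, {2,3,4,7}, {2,5,6,7}, {3,4,5,7}, {3,5,6,7}, {1,2,3,6}, {2,3,4,6}, {1,3,4,5}, {1,2,3,5}, {1,4,5,6}, {2,4,5,6}}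
/-- The complex `N2` from the paper, generated by its facets. -/
def N2 : NPM.Complex ℕ :=
  NPM.genCx {{1,2,4,8}, {2,4,5,8}, {2,3,5,8}, {3,5,6,8}, {3,4,6,8}, {4,6,7,8}, {4,5,7,8}, {1,5,7,8}, {1,5,6,8}, {1,2,6,8}, {2,6,7,8}, {2,3,7,8}, {1,3,7,8}, {1,3,4,8}, {1,2,4,7}, {2,4,5,7}, {2,3,5,7}, {3,5,6,7}, {3,4,6,7}, {1,5,6,7}, {1,2,6,7}, {1,3,4,7}}
/-- The complex `N3` from the paper, generated by its facets. -/
def N3 : NPM.Complex ℕ :=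
  NPM.genCx {{1,2,4,8}, {1,2,6,8}, {1,3,4,8}, {1,3,7,8}, {1,5,6,8}, {1,5,7,8}, {2,3,5,8}, {2,3,7,8}, {2,4,5,8}, {2,6,7,8}, {3,4,6,8}, {3,5,6,8}, {4,5,7,8}, {4,6,7,8}, {1,2,3,4}, {2,3,4,7}, {2,4,5,6}, {2,4,6,7}, {3,4,5,6}, {3,4,5,7}, {1,2,3,5}, {1,2,5,6}, {1,3,5,7}}
/-- The complex `N4` from the paper, generated by its facets. -/
def N4 : NPM.Complex ℕ :=
  NPM.genCx {{1,2,4,8}, {1,2,6,8}, {1,3,4,8}, {1,3,7,8}, {1,5,6,8}, {1,5,7,8}, {2,3,5,8}, {2,3,7,8}, {2,4,5,8}, {2,6,7,8}, {3,4,6,8}, {3,5,6,8}, {4,5,7,8}, {4,6,7,8}, {1,2,4,5}, {1,2,5,6}, {2,3,5,6}, {2,3,6,7}, {3,4,6,7}, {1,3,4,7}, {1,4,5,7}}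
/-- The complex `N5` from the paper, generated by its facets. -/
def N5 : NPM.Complex ℕ :=
  NPM.genCx {{1,2,5,8}, {1,2,6,8}, {1,3,5,8}, {1,3,7,8}, {1,4,6,8}, {1,4,7,8}, {2,3,6,8}, {2,3,7,8}, {2,4,5,8}, {2,4,7,8}, {3,4,5,8}, {3,4,6,8}, {1,2,5,7}, {1,2,6,7}, {1,3,6,7}, {1,4,5,7}, {2,3,5,7}, {2,4,6,7}, {3,4,5,7}, {3,4,6,7}, {2,3,5,6}, {2,4,5,6}, {1,3,5,6}, {1,4,5,6}}
/-- The complex `N6` from the paper, generated by its facets. -/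
def N6 : NPM.Complex ℕ :=
  NPM.genCx {{1,3,5,8}, {1,3,7,8}, {1,4,6,8}, {1,4,7,8}, {1,5,6,8}, {2,3,6,8}, {2,3,7,8}, {2,4,5,8}, {2,4,7,8}, {2,5,6,8}, {3,4,5,8}, {3,4,6,8}, {1,2,3,5}, {1,2,4,5}, {1,4,5,7}, {1,5,6,7}, {2,3,5,7}, {2,5,6,7}, {3,4,5,7}, {1,2,3,6}, {1,2,4,6}, {1,3,6,7}, {2,4,6,7}, {3,4,6,7}}
/-- The complex `N7` from the paper, generated by its facets. -/
def N7 : NPM.Complex ℕ :=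
  NPM.genCx {{1,2,6,8}, {1,2,5,8}, {1,3,5,8}, {1,3,7,8}, {1,4,7,8}, {1,4,6,8}, {2,3,7,8}, {2,3,6,8}, {2,4,5,8}, {2,4,7,8}, {3,4,6,8}, {3,4,5,8}, {1,3,5,6}, {1,3,6,7}, {2,3,5,7}, {2,3,5,6}, {3,4,6,7}, {3,4,5,7}, {1,2,5,6}, {1,4,6,7}, {2,4,5,7}}
/-- `N_8 = κ_{348}(κ_{238}(κ_{56}(κ_{67}(N_7))))`. -/
def N8 : NPM.Complex ℕ :=
  NPM.kappa 3 (NPM.kappa 3 (NPM.kappa 3 (NPM.kappa 3 N7 {6,7}) {5,6}) {2,3,8}) {3,4,8}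
/-- `N_9 = κ_{235}(κ_{67}(N_7))`. -/
def N9 : NPM.Complex ℕ := NPM.kappa 3 (NPM.kappa 3 N7 {6,7}) {2,3,5}
/-- `N_10 = κ_{148}(κ_{67}(N_7))`. -/
def N10 : NPM.Complex ℕ := NPM.kappa 3 (NPM.kappa 3 N7 {6,7}) {1,4,8}
/-- `N_11 = κ_{348}(κ_{56}(N_10))`. -/
def N11 : NPM.Complex ℕ := NPM.kappa 3 (NPM.kappa 3 N10 {5,6}) {3,4,8}
/-- `N_12 = κ_{457}(κ_{23}(N_9))`. -/
def N12 : NPM.Complex ℕ := NPM.kappa 3 (NPM.kappa 3 N9 {2,3}) {4,5,7}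
/-- `N_13 = κ_{567}(κ_{23}(N_9))`. -/
def N13 : NPM.Complex ℕ := NPM.kappa 3 (NPM.kappa 3 N9 {2,3}) {5,6,7}
/-- `N_14 = κ_{138}(κ_{57}(N_8))`. -/
def N14 : NPM.Complex ℕ := NPM.kappa 3 (NPM.kappa 3 N8 {5,7}) {1,3,8}
/-- `N_15 = κ_{158}(κ_{23}(N_9))`. -/
def N15 : NPM.Complex ℕ := NPM.kappa 3 (NPM.kappa 3 N9 {2,3}) {1,5,8}

namespace NPM

section Walks

variable {α β : Type*} [DecidableEq α] [DecidableEq β]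

/-- The number of walks of length `k` starting at `s` in the multigraph on `F` in which
`s` and `t` are joined by `|s ∩ t| ^ 2` edges. -/
def walksFrom (F : Finset (Finset α)) : ℕ → Finset α → ℕ
  | 0, _ => 1
  | k + 1, s => ∑ t ∈ F, (s ∩ t).card ^ 2 * walksFrom F k t

/-- The number of walks of length three on the facets of a `3`-dimensional complex, two facets
being joined by `|s ∩ t| ^ 2` edges. This is an isomorphism invariant. -/
def facetWalks (K : Complex α) : ℕ :=
  ∑ s ∈ facets K 3, walksFrom (facets K 3) 3 s

theorem subset_verts {K : Complex α} {s : Finset α} (hs : s ∈ K) : s ⊆ verts K :=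
  Finset.le_sup (f := id) hs

theorem walksFrom_image {f : α → β} {V : Finset α} (hf : Set.InjOn f V)
    {F : Finset (Finset α)} (hF : ∀ s ∈ F, s ⊆ V) (k : ℕ) {s : Finset α} (hs : s ⊆ V) :
    walksFrom (F.image (Finset.image f)) k (s.image f) = walksFrom F k s := by
  induction k generalizing s with
  | zero => rfl
  | succ k ih =>
    have hinj : Set.InjOn (Finset.image f) F := fun a ha b hb h =>
      Finset.image_injOn_powerset_of_injOn hf (by simpa using hF a ha)
        (by simpa using hF b hb) h
    simp only [walksFrom]
    rw [Finset.sum_image hinj]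
    refine Finset.sum_congr rfl fun t ht => ?_
    rw [ih (hF t ht), ← Finset.image_inter_of_injOn, Finset.card_image_of_injOn]
    · exact hf.mono (Finset.coe_subset.2 (Finset.inter_subset_left.trans hs))
    · exact hf.mono (by simpa using ⟨hs, hF t ht⟩)

theorem facets_image {f : α → β} {K : Complex α} (hf : Set.InjOn f (verts K)) (d : ℕ) :
    facets (K.image (Finset.image f)) d = (facets K d).image (Finset.image f) := by
  simp only [facets, Finset.filter_image]
  congr 1
  refine Finset.filter_congr fun s hs => ?_
  rw [Finset.card_image_of_injOn (hf.mono (Finset.coe_subset.2 (subset_verts hs)))]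

theorem Iso.facetWalks_eq {K : Complex α} {L : Complex β} (h : Iso K L) :
    facetWalks K = facetWalks L := by
  obtain ⟨f, hf, rfl⟩ := h
  have hF : ∀ s ∈ facets K 3, s ⊆ verts K := fun s hs =>
    subset_verts (Finset.mem_of_mem_filter s hs)
  rw [facetWalks, facetWalks, facets_image hf, Finset.sum_image]
  · exact Finset.sum_congr rfl fun s hs => (walksFrom_image hf hF 3 (hF s hs)).symm
  · exact fun a ha b hb h => Finset.image_injOn_powerset_of_injOn hf
      (by simpa using hF a ha) (by simpa using hF b hb) h

theorem mem_genCx {F : Finset (Finset α)} {s : Finset α} :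
    s ∈ genCx F ↔ s.Nonempty ∧ ∃ t ∈ F, s ⊆ t := by
  simp only [genCx, Finset.mem_biUnion, Finset.mem_filter, Finset.mem_powerset]
  tauto

theorem facets_genCx {F : Finset (Finset α)} {d : ℕ} (hF : ∀ s ∈ F, s.card = d + 1) :
    facets (genCx F) d = F := by
  ext s
  simp only [facets, Finset.mem_filter, mem_genCx]
  constructor
  · rintro ⟨⟨-, t, ht, hst⟩, hs⟩
    rwa [Finset.eq_of_subset_of_card_le hst (by rw [hs, hF t ht])]
  · intro hs
    have h := hF s hs
    exact ⟨⟨Finset.card_pos.1 (by lia), s, hs, subset_rfl⟩, h⟩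

/-- The bistellar move on the face `A`, computed on the set `F` of facets. -/
def moveFacets (F : Finset (Finset α)) (A : Finset α) : Finset (Finset α) :=
  F.filter (fun s => ¬ A ⊆ s) ∪
    A.image fun v => ((F.filter fun s => A ⊆ s).sup id ∪ A).erase v

theorem verts_link_union {F : Finset (Finset α)} {A : Finset α} :
    verts (link (genCx F) A) ∪ A = (F.filter fun s => A ⊆ s).sup id ∪ A := by
  ext x
  simp only [verts, link, Finset.mem_union, Finset.mem_sup, Finset.mem_filter, mem_genCx, id]
  by_cases hx : x ∈ A
  · simp [hx]
  simp only [hx, or_false]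
  constructor
  · rintro ⟨s, ⟨-, -, -, t, ht, hst⟩, hxs⟩
    exact ⟨t, ⟨ht, Finset.union_subset_left hst⟩, hst (Finset.mem_union_right _ hxs)⟩
  · rintro ⟨t, ⟨ht, hAt⟩, hxt⟩
    have hsub : A ∪ {x} ⊆ t := Finset.union_subset hAt (by simpa using hxt)
    exact ⟨{x}, ⟨⟨by simp, t, ht, by simpa using hxt⟩, by simpa using hx,
      ⟨x, by simp⟩, t, ht, hsub⟩, by simp⟩

theorem kappa_genCx {F : Finset (Finset α)} {d : ℕ} (hF : ∀ s ∈ F, s.card = d + 1)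
    (A : Finset α) : kappa d (genCx F) A = genCx (moveFacets F A) := by
  rw [kappa, facets_genCx hF, verts_link_union, moveFacets]

theorem facetWalks_genCx {F : Finset (Finset α)} (hF : ∀ s ∈ F, s.card = 4) :
    facetWalks (genCx F) = ∑ s ∈ F, walksFrom F 3 s := by
  rw [facetWalks, facets_genCx hF]

end Walks

end NPM

open NPM

theorem N8_eq_genCx : N8 = genCx
    {{1, 2, 3, 5}, {1, 2, 3, 6}, {1, 2, 5, 8}, {1, 2, 6, 8}, {1, 3, 4, 6}, {1, 3, 4, 7}, {1, 3, 5, 8},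
      {1, 3, 7, 8}, {1, 4, 6, 8}, {1, 4, 7, 8}, {2, 3, 5, 7}, {2, 3, 6, 7}, {2, 4, 5, 7}, {2, 4, 5, 8},
      {2, 4, 7, 8}, {2, 6, 7, 8}, {3, 4, 5, 6}, {3, 4, 5, 7}, {3, 5, 6, 8}, {3, 6, 7, 8}, {4, 5, 6, 8}} := by
  rw [N8, N7, kappa_genCx (by decide +kernel), kappa_genCx (by decide +kernel),
    kappa_genCx (by decide +kernel), kappa_genCx (by decide +kernel)]
  exact congrArg genCx (by decide +kernel)

theorem N9_eq_genCx : N9 = genCx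
    {{1, 2, 5, 6}, {1, 2, 5, 8}, {1, 2, 6, 8}, {1, 3, 4, 6}, {1, 3, 4, 7}, {1, 3, 5, 6}, {1, 3, 5, 8},
      {1, 3, 7, 8}, {1, 4, 6, 8}, {1, 4, 7, 8}, {2, 3, 6, 7}, {2, 3, 6, 8}, {2, 3, 7, 8}, {2, 4, 5, 7},
      {2, 4, 5, 8}, {2, 4, 7, 8}, {2, 5, 6, 7}, {3, 4, 5, 7}, {3, 4, 5, 8}, {3, 4, 6, 8}, {3, 5, 6, 7}} := by
  rw [N9, N7, kappa_genCx (by decide +kernel), kappa_genCx (by decide +kernel)]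
  exact congrArg genCx (by decide +kernel)

theorem N10_eq_genCx : N10 = genCx
    {{1, 2, 5, 6}, {1, 2, 5, 8}, {1, 2, 6, 8}, {1, 3, 4, 6}, {1, 3, 4, 7}, {1, 3, 5, 6}, {1, 3, 5, 8},
      {1, 3, 7, 8}, {1, 4, 6, 7}, {1, 6, 7, 8}, {2, 3, 5, 6}, {2, 3, 5, 7}, {2, 3, 6, 8}, {2, 3, 7, 8},
      {2, 4, 5, 7}, {2, 4, 5, 8}, {2, 4, 7, 8}, {3, 4, 5, 7}, {3, 4, 5, 8}, {3, 4, 6, 8}, {4, 6, 7, 8}} := by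
  rw [N10, N7, kappa_genCx (by decide +kernel), kappa_genCx (by decide +kernel)]
  exact congrArg genCx (by decide +kernel)

theorem N11_eq_genCx : N11 = genCx
    {{1, 2, 3, 5}, {1, 2, 3, 6}, {1, 2, 5, 8}, {1, 2, 6, 8}, {1, 3, 4, 6}, {1, 3, 4, 7}, {1, 3, 5, 8},
      {1, 3, 7, 8}, {1, 4, 6, 7}, {1, 6, 7, 8}, {2, 3, 5, 7}, {2, 3, 6, 8}, {2, 3, 7, 8}, {2, 4, 5, 7},
      {2, 4, 5, 8}, {2, 4, 7, 8}, {3, 4, 5, 6}, {3, 4, 5, 7}, {3, 5, 6, 8}, {4, 5, 6, 8}, {4, 6, 7, 8}} := by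
  rw [N11, N10_eq_genCx, kappa_genCx (by decide +kernel), kappa_genCx (by decide +kernel)]
  exact congrArg genCx (by decide +kernel)

theorem N12_eq_genCx : N12 = genCx
    {{1, 2, 5, 6}, {1, 2, 5, 8}, {1, 2, 6, 8}, {1, 3, 4, 6}, {1, 3, 4, 7}, {1, 3, 5, 6}, {1, 3, 5, 8},
      {1, 3, 7, 8}, {1, 4, 6, 8}, {1, 4, 7, 8}, {2, 3, 4, 5}, {2, 3, 4, 7}, {2, 3, 5, 7}, {2, 4, 5, 8},
      {2, 4, 7, 8}, {2, 5, 6, 7}, {2, 6, 7, 8}, {3, 4, 5, 8}, {3, 4, 6, 8}, {3, 5, 6, 7}, {3, 6, 7, 8}} := by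
  rw [N12, N9_eq_genCx, kappa_genCx (by decide +kernel), kappa_genCx (by decide +kernel)]
  exact congrArg genCx (by decide +kernel)

theorem N13_eq_genCx : N13 = genCx
    {{1, 2, 5, 6}, {1, 2, 5, 8}, {1, 2, 6, 8}, {1, 3, 4, 6}, {1, 3, 4, 7}, {1, 3, 5, 6}, {1, 3, 5, 8},
      {1, 3, 7, 8}, {1, 4, 6, 8}, {1, 4, 7, 8}, {2, 3, 5, 6}, {2, 3, 5, 7}, {2, 3, 6, 7}, {2, 4, 5, 7},
      {2, 4, 5, 8}, {2, 4, 7, 8}, {2, 6, 7, 8}, {3, 4, 5, 7}, {3, 4, 5, 8}, {3, 4, 6, 8}, {3, 6, 7, 8}} := by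
  rw [N13, N9_eq_genCx, kappa_genCx (by decide +kernel), kappa_genCx (by decide +kernel)]
  exact congrArg genCx (by decide +kernel)

theorem N14_eq_genCx : N14 = genCx
    {{1, 2, 3, 5}, {1, 2, 3, 6}, {1, 2, 5, 8}, {1, 2, 6, 8}, {1, 3, 4, 6}, {1, 3, 4, 7}, {1, 3, 5, 7},
      {1, 4, 6, 8}, {1, 4, 7, 8}, {1, 5, 7, 8}, {2, 3, 4, 5}, {2, 3, 4, 7}, {2, 3, 6, 7}, {2, 4, 5, 8},
      {2, 4, 7, 8}, {2, 6, 7, 8}, {3, 4, 5, 6}, {3, 5, 6, 8}, {3, 5, 7, 8}, {3, 6, 7, 8}, {4, 5, 6, 8}} := by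
  rw [N14, N8_eq_genCx, kappa_genCx (by decide +kernel), kappa_genCx (by decide +kernel)]
  exact congrArg genCx (by decide +kernel)

theorem N15_eq_genCx : N15 = genCx
    {{1, 2, 3, 5}, {1, 2, 3, 8}, {1, 2, 5, 6}, {1, 2, 6, 8}, {1, 3, 4, 6}, {1, 3, 4, 7}, {1, 3, 5, 6},
      {1, 3, 7, 8}, {1, 4, 6, 8}, {1, 4, 7, 8}, {2, 3, 5, 8}, {2, 4, 5, 7}, {2, 4, 5, 8}, {2, 4, 7, 8},
      {2, 5, 6, 7}, {2, 6, 7, 8}, {3, 4, 5, 7}, {3, 4, 5, 8}, {3, 4, 6, 8}, {3, 5, 6, 7}, {3, 6, 7, 8}} := by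
  rw [N15, N9_eq_genCx, kappa_genCx (by decide +kernel), kappa_genCx (by decide +kernel)]
  exact congrArg genCx (by decide +kernel)

theorem facetWalks_N1 : facetWalks N1 = 58720256 := by
  rw [N1, facetWalks_genCx (by decide +kernel)]
  decide +kernel

theorem facetWalks_N2 : facetWalks N2 = 26067824 := by
  rw [N2, facetWalks_genCx (by decide +kernel)]
  decide +kernel

theorem facetWalks_N3 : facetWalks N3 = 29513704 := by
  rw [N3, facetWalks_genCx (by decide +kernel)]
  decide +kernel

theorem facetWalks_N4 : facetWalks N4 = 21150528 := by
  rw [N4, facetWalks_genCx (by decide +kernel)]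
  decide +kernel

theorem facetWalks_N5 : facetWalks N5 = 33718272 := by
  rw [N5, facetWalks_genCx (by decide +kernel)]
  decide +kernel

theorem facetWalks_N6 : facetWalks N6 = 32533120 := by
  rw [N6, facetWalks_genCx (by decide +kernel)]
  decide +kernel

theorem facetWalks_N7 : facetWalks N7 = 21064320 := by
  rw [N7, facetWalks_genCx (by decide +kernel)]
  decide +kernel

theorem facetWalks_N8 : facetWalks N8 = 20559792 := by
  rw [N8_eq_genCx, facetWalks_genCx (by decide +kernel)]
  decide +kernel

theorem facetWalks_N9 : facetWalks N9 = 20592976 := by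
  rw [N9_eq_genCx, facetWalks_genCx (by decide +kernel)]
  decide +kernel

theorem facetWalks_N10 : facetWalks N10 = 20592256 := by
  rw [N10_eq_genCx, facetWalks_genCx (by decide +kernel)]
  decide +kernel

theorem facetWalks_N11 : facetWalks N11 = 20576056 := by
  rw [N11_eq_genCx, facetWalks_genCx (by decide +kernel)]
  decide +kernel

theorem facetWalks_N12 : facetWalks N12 = 20576416 := by
  rw [N12_eq_genCx, facetWalks_genCx (by decide +kernel)]
  decide +kernel

theorem facetWalks_N13 : facetWalks N13 = 20811736 := by
  rw [N13_eq_genCx, facetWalks_genCx (by decide +kernel)]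
  decide +kernel

theorem facetWalks_N14 : facetWalks N14 = 20308488 := by
  rw [N14_eq_genCx, facetWalks_genCx (by decide +kernel)]
  decide +kernel

theorem facetWalks_N15 : facetWalks N15 = 20592880 := by
  rw [N15_eq_genCx, facetWalks_genCx (by decide +kernel)]
  decide +kernel

/-- the fifteen complexes `N_1, …, N_15` are pairwise
non-isomorphic. -/
theorem statement7 :
    ([N1, N2, N3, N4, N5, N6, N7, N8, N9, N10, N11, N12, N13, N14, N15] :
        List (NPM.Complex ℕ)).Pairwise (fun X Y => ¬ NPM.Iso X Y) := by
  have key : ([N1, N2, N3, N4, N5, N6, N7, N8, N9, N10, N11, N12, N13, N14, N15].map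
      facetWalks).Nodup := by
    simp only [List.map_cons, List.map_nil,
      facetWalks_N1, facetWalks_N2, facetWalks_N3, facetWalks_N4,
      facetWalks_N5, facetWalks_N6, facetWalks_N7, facetWalks_N8, facetWalks_N9,
      facetWalks_N10, facetWalks_N11, facetWalks_N12, facetWalks_N13, facetWalks_N14,
      facetWalks_N15]
    decide +kernel
  exact (List.pairwise_map.1 key).imp fun hne hiso => hne (Iso.facetWalks_eq hiso)
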